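/- For all n ≥ 2 and d ≥ 1 there exist constants δ(n,d) > 0 and C(n,d) > 1 such that for any harmonic polynomial h : ℝⁿ → ℝ of degree d and any x ∈ Σ_h: (a) Dh(x) = 0 if and only if θ_{Σ_h}(x,r) ≥ δ(n,d) for all r > 0; (b) Dh(x) ≠ 0 if and only if θ_{Σ_h}(x,r) < δ(n,d) for some r > 0; (c) if θ_{Σ_h}(x,r) < δ(n,d) for some r > 0, then θ_{Σ_h}(x,sr) < C(n,d)·s for all s ∈ (0,1). -/

import Mathlib

open MvPolynomial Metric Filter
open scoped ENNReal

/-- Evaluate a multivariate polynomial at a point of Euclidean space. -/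
noncomputable def evalPt {n : ℕ} (p : MvPolynomial (Fin n) ℝ)
    (y : EuclideanSpace ℝ (Fin n)) : ℝ :=
  MvPolynomial.eval (fun i => y i) p

/-- The zero set of a polynomial. -/
def zeroSet {n : ℕ} (p : MvPolynomial (Fin n) ℝ) : Set (EuclideanSpace ℝ (Fin n)) :=
  {y | evalPt p y = 0}

/-- The polynomial y ↦ p(y + x). -/
noncomputable def translatePoly {n : ℕ} (p : MvPolynomial (Fin n) ℝ)
    (x : EuclideanSpace ℝ (Fin n)) : MvPolynomial (Fin n) ℝ :=
  MvPolynomial.bind₁ (fun i => MvPolynomial.X i + MvPolynomial.C (x i)) p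

/-- The homogeneous part of degree `k` of `p` centered at `x`. -/
noncomputable def homPart {n : ℕ} (p : MvPolynomial (Fin n) ℝ)
    (x : EuclideanSpace ℝ (Fin n)) (k : ℕ) : MvPolynomial (Fin n) ℝ :=
  MvPolynomial.homogeneousComponent k (translatePoly p x)

/-- The sup norm of |q| on the closed ball B(0,r), as an extended nonnegative real. -/
noncomputable def supNormBall {n : ℕ} (q : MvPolynomial (Fin n) ℝ) (r : ℝ) : ℝ≥0∞ :=
  ⨆ y ∈ Metric.closedBall (0 : EuclideanSpace ℝ (Fin n)) r, ENNReal.ofReal |evalPt q y|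

/-- ζ_k(p,x,r): the relative size of the homogeneous part of degree k of a polynomial of
degree d, centered at x, on the ball of radius r. -/
noncomputable def zeta {n : ℕ} (d : ℕ) (p : MvPolynomial (Fin n) ℝ)
    (x : EuclideanSpace ℝ (Fin n)) (k : ℕ) (r : ℝ) : ℝ≥0∞ :=
  ⨆ j ∈ (Finset.range (d + 1)).erase k,
    supNormBall (homPart p x j) r / supNormBall (homPart p x k) r

/-- A polynomial is harmonic if its Laplacian vanishes. -/
def IsHarmonic {n : ℕ} (p : MvPolynomial (Fin n) ℝ) : Prop :=
  ∑ i : Fin n, MvPolynomial.pderiv i (MvPolynomial.pderiv i p) = 0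

/-- The local flatness θ_Σ(x,r): the normalized minimal Hausdorff distance between
Σ ∩ B(x,r) and (x + L) ∩ B(x,r) over hyperplanes L through the origin. -/
noncomputable def flatness {n : ℕ} (A : Set (EuclideanSpace ℝ (Fin n)))
    (x : EuclideanSpace ℝ (Fin n)) (r : ℝ) : ℝ :=
  (1 / r) * ⨅ L : {L : Submodule ℝ (EuclideanSpace ℝ (Fin n)) // Module.finrank ℝ L = n - 1},
    Metric.hausdorffDist (A ∩ Metric.closedBall x r)
      (((fun y => x + y) '' (L.1 : Set (EuclideanSpace ℝ (Fin n)))) ∩ Metric.closedBall x r)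

/-- Dp(x) ≠ 0 : some partial derivative of p is nonzero at x. -/
def gradNeZero {n : ℕ} (p : MvPolynomial (Fin n) ℝ) (x : EuclideanSpace ℝ (Fin n)) : Prop :=
  ∃ i : Fin n, MvPolynomial.eval (fun j => x j) (MvPolynomial.pderiv i p) ≠ 0

/-- Sup of |h| on the unit sphere. -/
noncomputable def sphereSup {n : ℕ} (h : MvPolynomial (Fin n) ℝ) : ℝ :=
  sSup ((fun θ => |evalPt h θ|) '' Metric.sphere (0 : EuclideanSpace ℝ (Fin n)) 1)

/-- The polynomial y ↦ p(t·y). -/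
noncomputable def dilatePoly {n : ℕ} (p : MvPolynomial (Fin n) ℝ) (t : ℝ) :
    MvPolynomial (Fin n) ℝ :=
  MvPolynomial.bind₁ (fun i => MvPolynomial.C t * MvPolynomial.X i) p

theorem continuous_evalPt {n : ℕ} (p : MvPolynomial (Fin n) ℝ) : Continuous (evalPt p) := by
  unfold evalPt
  exact (MvPolynomial.continuous_eval p).comp (by fun_prop)

theorem hasDerivAt_evalPt_line {n : ℕ} (p : MvPolynomial (Fin n) ℝ)
    (y v : EuclideanSpace ℝ (Fin n)) (t : ℝ) :
    HasDerivAt (fun t : ℝ => evalPt p (y + t • v))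
      (∑ i, v i * evalPt (pderiv i p) (y + t • v)) t := by
  unfold evalPt
  induction p using MvPolynomial.induction_on with
  | C a => simpa using hasDerivAt_const t a
  | add p q hp hq =>
    simp only [map_add, mul_add, Finset.sum_add_distrib]
    exact hp.fun_add hq
  | mul_X p j hp =>
    have h1 : HasDerivAt (fun t : ℝ => y j + t * v j) (v j) t := by
      simpa using ((hasDerivAt_id t).mul_const (v j)).const_add (y j)
    have h2 := hp.mul h1
    simp only [map_mul, eval_X]
    refine h2.congr_deriv ?_
    simp only [Derivation.leibniz, pderiv_X, smul_eq_mul, map_add, map_mul, eval_X, mul_add,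
      Finset.sum_add_distrib, Finset.sum_mul, PiLp.add_apply, PiLp.smul_apply]
    rw [add_comm, ← Finset.sum_add_distrib, ← Finset.sum_add_distrib]
    have hj : (∑ i, v i * (eval (fun i => y i + t * v i) p *
        eval (fun i => y i + t * v i) ((Pi.single i 1 : Fin n → MvPolynomial (Fin n) ℝ) j))) =
        eval (fun i => y i + t * v i) p * v j := by
      rw [Finset.sum_eq_single j]
      · simp [mul_comm]
      · intro b _ hb
        simp [hb.symm]
      · simp
    simp only [Finset.sum_add_distrib] at hj ⊢
    rw [hj, add_right_inj, ← Finset.sum_add_distrib]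
    exact Finset.sum_congr rfl fun i _ => by ring

theorem evalPt_laplacian_nonneg_of_isLocalMin {n : ℕ} {p : MvPolynomial (Fin n) ℝ}
    {y : EuclideanSpace ℝ (Fin n)} (hy : IsLocalMin (evalPt p) y) :
    0 ≤ ∑ i, evalPt (pderiv i (pderiv i p)) y := by
  refine Finset.sum_nonneg fun i _ => ?_
  by_contra! hneg
  set v : EuclideanSpace ℝ (Fin n) := EuclideanSpace.single i 1
  have key (q : MvPolynomial (Fin n) ℝ) (t : ℝ) :
      HasDerivAt (fun t : ℝ => evalPt q (y + t • v)) (evalPt (pderiv i q) (y + t • v)) t := by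
    simpa [v, Pi.single_apply] using hasDerivAt_evalPt_line q y v t
  set g : ℝ → ℝ := fun t => evalPt p (y + t • v) with hg
  have d1 : deriv g = fun t => evalPt (pderiv i p) (y + t • v) := funext fun t => (key p t).deriv
  have d2 : deriv (deriv g) 0 = evalPt (pderiv i (pderiv i p)) y := by
    rw [d1, (key (pderiv i p) 0).deriv]; simp
  have hmin : IsLocalMin g 0 := by
    have hc : ContinuousAt (fun t : ℝ => y + t • v) 0 := by fun_prop
    have : IsLocalMin (evalPt p) ((fun t : ℝ => y + t • v) 0) := by simpa using hy
    exact IsLocalMin.comp_continuous (g := fun t : ℝ => y + t • v) this hc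
  have hmax : IsLocalMax g 0 :=
    isLocalMax_of_deriv_deriv_neg (by rw [d2]; exact hneg) hmin.deriv_eq_zero
      (key p 0).continuousAt
  have hconst : g =ᶠ[nhds 0] fun _ => g 0 := by
    filter_upwards [hmin, hmax] with t h1 h2 using le_antisymm h2 h1
  have h0 : deriv (deriv g) 0 = 0 := by
    rw [hconst.deriv.deriv_eq]; simp
  linarith

/-- The polynomial `y ↦ R² - |y - c|²`. -/
noncomputable def ballPoly {n : ℕ} (c : EuclideanSpace ℝ (Fin n)) (R : ℝ) :
    MvPolynomial (Fin n) ℝ :=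
  C (R ^ 2) - ∑ i, (X i - C (c i)) ^ 2

theorem evalPt_ballPoly {n : ℕ} (c : EuclideanSpace ℝ (Fin n)) (R : ℝ)
    (y : EuclideanSpace ℝ (Fin n)) : evalPt (ballPoly c R) y = R ^ 2 - ‖y - c‖ ^ 2 := by
  simp [evalPt, ballPoly, EuclideanSpace.norm_sq_eq]

theorem pderiv_ballPoly {n : ℕ} (c : EuclideanSpace ℝ (Fin n)) (R : ℝ) (i : Fin n) :
    pderiv i (ballPoly c R) = C (-2) * (X i - C (c i)) := by
  simp only [ballPoly, map_sub, pderiv_C, map_sum, Derivation.leibniz_pow, pderiv_X]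
  rw [Finset.sum_eq_single i]
  · have h2 : (C (-2) : MvPolynomial (Fin n) ℝ) = -2 := by rw [map_neg, map_ofNat]
    simp [h2]
  · intro b _ hb
    simp [hb]
  · simp

/-- A polynomial which is subharmonic close to the sphere of radius `R` centered at `c`, vanishes
on that sphere and is positive inside it. -/
noncomputable def barrierPoly {n : ℕ} (c : EuclideanSpace ℝ (Fin n)) (R : ℝ) :
    MvPolynomial (Fin n) ℝ :=
  ballPoly c R + C (n / R ^ 2) * ballPoly c R ^ 2

theorem evalPt_barrierPoly {n : ℕ} (c : EuclideanSpace ℝ (Fin n)) (R : ℝ)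
    (y : EuclideanSpace ℝ (Fin n)) : evalPt (barrierPoly c R) y =
      (R ^ 2 - ‖y - c‖ ^ 2) + n / R ^ 2 * (R ^ 2 - ‖y - c‖ ^ 2) ^ 2 := by
  rw [← evalPt_ballPoly]
  simp [evalPt, barrierPoly]

theorem laplacian_barrierPoly {n : ℕ} (c : EuclideanSpace ℝ (Fin n)) (R : ℝ)
    (y : EuclideanSpace ℝ (Fin n)) :
    ∑ i, evalPt (pderiv i (pderiv i (barrierPoly c R))) y =
      -(2 * n) + n / R ^ 2 * (8 * ‖y - c‖ ^ 2 - 4 * n * (R ^ 2 - ‖y - c‖ ^ 2)) := by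
  have h (i : Fin n) : evalPt (pderiv i (pderiv i (barrierPoly c R))) y =
      -2 + n / R ^ 2 * (8 * (y i - c i) ^ 2 - 4 * (R ^ 2 - ‖y - c‖ ^ 2)) := by
    rw [← evalPt_ballPoly]
    simp only [barrierPoly, map_add, Derivation.leibniz, Derivation.leibniz_pow, pderiv_C,
      smul_eq_mul, evalPt, map_mul, eval_C, pow_one, map_pow,
      pderiv_ballPoly, map_sub, pderiv_X, map_zero, nsmul_eq_mul, Nat.add_one_sub_one, map_natCast,
      eval_X]
    have h2 : pderiv i (2 : MvPolynomial (Fin n) ℝ) = 0 := by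
      simpa using (pderiv i).map_natCast 2
    simp only [Pi.single_eq_same, map_one]
    ring_nf
    simp only [h2, map_zero]
    ring
  have hs : ∑ i, (y i - c i) ^ 2 = ‖y - c‖ ^ 2 := by simp [EuclideanSpace.norm_sq_eq]
  simp only [h, Finset.sum_add_distrib, ← Finset.mul_sum, Finset.sum_sub_distrib, hs]
  simp
  ring

theorem IsHarmonic.sum_evalPt {n : ℕ} {p : MvPolynomial (Fin n) ℝ} (hp : IsHarmonic p)
    (y : EuclideanSpace ℝ (Fin n)) : ∑ i, evalPt (pderiv i (pderiv i p)) y = 0 := by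
  have := congrArg (fun q => evalPt q y) hp
  simpa [evalPt] using this

/-- The barrier comparison at the heart of the Hopf boundary point lemma. -/
theorem IsHarmonic.exists_mul_barrierPoly_le {n : ℕ} (hn : 0 < n) {p : MvPolynomial (Fin n) ℝ}
    (hp : IsHarmonic p) {c : EuclideanSpace ℝ (Fin n)} {R : ℝ} (hR : 0 < R)
    (hpos : ∀ y ∈ ball c R, 0 < evalPt p y) :
    ∃ ε > 0, ∃ ρ, 0 ≤ ρ ∧ ρ < R ∧ ∀ y, ρ ≤ ‖y - c‖ → ‖y - c‖ ≤ R →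
      ε * evalPt (barrierPoly c R) y ≤ evalPt p y := by
  have hn' : (0 : ℝ) < n := by exact_mod_cast hn
  have hnonneg : ∀ y ∈ closedBall c R, 0 ≤ evalPt p y := by
    rw [← closure_ball c hR.ne']
    intro y hy
    exact le_on_closure (f := fun _ => (0 : ℝ)) (fun z hz => (hpos z hz).le) continuousOn_const
      (continuous_evalPt p).continuousOn hy
  obtain ⟨ρ, hρ0, hρR, hρ⟩ : ∃ ρ, 0 < ρ ∧ ρ < R ∧ R ^ 2 * (n + 1) < ρ ^ 2 * (n + 2) := by
    have hcont : ContinuousAt (fun ρ : ℝ => ρ ^ 2 * ((n : ℝ) + 2)) R := by fun_prop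
    have h1 : ∀ᶠ ρ in nhds R, R ^ 2 * (n + 1) < ρ ^ 2 * (n + 2) :=
      hcont.eventually (lt_mem_nhds (by nlinarith [sq_pos_of_pos hR]))
    have h2 : ∀ᶠ ρ in nhdsWithin R (Set.Iio R),
        0 < ρ ∧ ρ < R ∧ R ^ 2 * (n + 1) < ρ ^ 2 * (n + 2) := by
      filter_upwards [nhdsWithin_le_nhds h1, nhdsWithin_le_nhds (lt_mem_nhds hR),
        self_mem_nhdsWithin] with ρ a b c using ⟨b, c, a⟩
    exact h2.exists
  obtain ⟨m, hm0, hm⟩ : ∃ m > 0, ∀ y, ‖y - c‖ = ρ → m ≤ evalPt p y := by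
    have hK : IsCompact (sphere c ρ) := isCompact_sphere c ρ
    rcases (sphere c ρ).eq_empty_or_nonempty with he | hne
    · refine ⟨1, one_pos, fun y hy => ?_⟩
      have : y ∈ sphere c ρ := by simpa [dist_eq_norm] using hy
      simp [he] at this
    · obtain ⟨y₀, hy₀, hmin⟩ := hK.exists_isMinOn hne (continuous_evalPt p).continuousOn
      refine ⟨evalPt p y₀, hpos _ ?_, fun y hy => hmin (by simpa [dist_eq_norm] using hy)⟩
      rw [mem_ball, mem_sphere.1 hy₀]
      exact hρR
  set B : ℝ := R ^ 2 + n / R ^ 2 * (R ^ 2) ^ 2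
  have hB : 0 < B := by positivity
  refine ⟨m / B, by positivity, ρ, hρ0.le, hρR, ?_⟩
  set ε := m / B
  have hε : 0 < ε := by positivity
  set w : MvPolynomial (Fin n) ℝ := p - C ε * barrierPoly c R with hw
  have hwe (y) : evalPt w y = evalPt p y - ε * evalPt (barrierPoly c R) y := by simp [evalPt, hw]
  set A : Set (EuclideanSpace ℝ (Fin n)) := {y | ρ ≤ ‖y - c‖ ∧ ‖y - c‖ ≤ R} with hA
  have hnc : Continuous fun y : EuclideanSpace ℝ (Fin n) => ‖y - c‖ := by fun_prop
  have hAc : IsCompact A := by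
    refine (isCompact_closedBall c R).of_isClosed_subset ?_ fun y hy => ?_
    · exact (isClosed_le continuous_const hnc).inter (isClosed_le hnc continuous_const)
    · simpa [dist_eq_norm] using hy.2
  suffices ∀ y ∈ A, 0 ≤ evalPt w y by
    intro y h1 h2
    have := this y ⟨h1, h2⟩
    rw [hwe] at this
    linarith
  intro y hy
  obtain ⟨y₀, hy₀, hmin⟩ := hAc.exists_isMinOn ⟨y, hy⟩ (continuous_evalPt w).continuousOn
  refine le_trans ?_ (hmin hy)
  rcases hy₀.1.eq_or_lt with h1 | h1
  · rw [hwe, evalPt_barrierPoly]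
    have hu : R ^ 2 - ‖y₀ - c‖ ^ 2 ≤ R ^ 2 := by linarith [sq_nonneg ‖y₀ - c‖]
    have hu0 : 0 ≤ R ^ 2 - ‖y₀ - c‖ ^ 2 := by
      rw [sub_nonneg]
      gcongr
      exact hy₀.2
    have : (R ^ 2 - ‖y₀ - c‖ ^ 2) + n / R ^ 2 * (R ^ 2 - ‖y₀ - c‖ ^ 2) ^ 2 ≤
        R ^ 2 + n / R ^ 2 * (R ^ 2) ^ 2 := by
      gcongr
    have h3 : ε * B = m := div_mul_cancel₀ _ hB.ne'
    have := mul_le_mul_of_nonneg_left this hε.le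
    change _ ≤ ε * B at this
    linarith [hm y₀ h1.symm]
  rcases hy₀.2.eq_or_lt with h2 | h2
  · rw [hwe, evalPt_barrierPoly, h2]
    have := hnonneg y₀ (by simp [dist_eq_norm, h2])
    simpa using this
  exfalso
  have hloc : IsLocalMin (evalPt w) y₀ := by
    have hU : {y | ρ < ‖y - c‖} ∩ {y | ‖y - c‖ < R} ∈ nhds y₀ :=
      ((isOpen_lt continuous_const hnc).inter (isOpen_lt hnc continuous_const)).mem_nhds ⟨h1, h2⟩
    filter_upwards [hU] with z hz using hmin ⟨hz.1.le, hz.2.le⟩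
  have hlap := evalPt_laplacian_nonneg_of_isLocalMin hloc
  have hlap' : ∑ i, evalPt (pderiv i (pderiv i w)) y₀ =
      ∑ i, evalPt (pderiv i (pderiv i p)) y₀ -
        ε * ∑ i, evalPt (pderiv i (pderiv i (barrierPoly c R))) y₀ := by
    rw [Finset.mul_sum, ← Finset.sum_sub_distrib]
    refine Finset.sum_congr rfl fun i _ => ?_
    simp [hw, evalPt, Derivation.leibniz]
  rw [hlap', hp.sum_evalPt, laplacian_barrierPoly] at hlap
  have hρy : ρ ^ 2 ≤ ‖y₀ - c‖ ^ 2 := by gcongr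
  have h4 : 4 * R ^ 2 < 8 * ‖y₀ - c‖ ^ 2 - 4 * n * (R ^ 2 - ‖y₀ - c‖ ^ 2) := by nlinarith
  have h5 : n / R ^ 2 * (4 * R ^ 2) <
      n / R ^ 2 * (8 * ‖y₀ - c‖ ^ 2 - 4 * n * (R ^ 2 - ‖y₀ - c‖ ^ 2)) := by gcongr
  have h6 : n / R ^ 2 * (4 * R ^ 2) = 4 * n := by field_simp
  have h7 := mul_pos hε (show 0 < -(2 * (n : ℝ)) + n / R ^ 2 *
    (8 * ‖y₀ - c‖ ^ 2 - 4 * n * (R ^ 2 - ‖y₀ - c‖ ^ 2)) by linarith)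
  linarith

/-- Hopf's boundary point lemma for harmonic polynomials. -/
theorem IsHarmonic.hopf {n : ℕ} (hn : 0 < n) {p : MvPolynomial (Fin n) ℝ}
    (hp : IsHarmonic p) {c z : EuclideanSpace ℝ (Fin n)} {R : ℝ} (hR : 0 < R)
    (hpos : ∀ y ∈ ball c R, 0 < evalPt p y) (hz : ‖z - c‖ = R) (hz0 : evalPt p z = 0) :
    0 < ∑ i, (c - z) i * evalPt (pderiv i p) z := by
  obtain ⟨ε, hε, ρ, hρ0, hρ, hle⟩ := hp.exists_mul_barrierPoly_le hn hR hpos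
  have hder := hasDerivAt_evalPt_line p z (c - z) 0
  simp only [zero_smul, add_zero] at hder
  refine lt_of_lt_of_le (b := ε * R ^ 2) (by positivity) ?_
  have hslope := (hasDerivAt_iff_tendsto_slope.1 hder).mono_left
    (nhdsWithin_mono (s := Set.Ioi 0) 0 (fun t (ht : 0 < t) => ht.ne'))
  refine ge_of_tendsto hslope ?_
  have hsmall : Set.Ioo 0 (1 - ρ / R) ∈ nhdsWithin (0 : ℝ) (Set.Ioi 0) :=
    Ioo_mem_nhdsGT (by rw [sub_pos, div_lt_one hR]; exact hρ)
  filter_upwards [hsmall] with t ht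
  have ht1 : t ≤ 1 := by linarith [ht.2, div_nonneg hρ0 hR.le]
  have hnorm : ‖z + t • (c - z) - c‖ = (1 - t) * R := by
    have : z + t • (c - z) - c = (1 - t) • (z - c) := by module
    rw [this, norm_smul, hz, Real.norm_of_nonneg (by linarith)]
  have hρ' : ρ ≤ (1 - t) * R := by
    rw [← div_le_iff₀ hR]
    linarith [ht.2]
  have := hle (z + t • (c - z)) (by rwa [hnorm]) (by rw [hnorm]; nlinarith [ht.1])
  rw [evalPt_barrierPoly, hnorm] at this
  rw [slope_def_field]
  simp only [zero_smul, add_zero, hz0, sub_zero]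
  rw [le_div_iff₀ ht.1]
  refine le_trans ?_ this
  have h1 : R ^ 2 * t ≤ R ^ 2 - ((1 - t) * R) ^ 2 := by
    have : 0 ≤ R ^ 2 * (t * (1 - t)) := by
      have := ht.1; have : 0 ≤ 1 - t := by linarith
      positivity
    nlinarith
  have h2 : 0 ≤ (n : ℝ) / R ^ 2 * (R ^ 2 - ((1 - t) * R) ^ 2) ^ 2 := by positivity
  calc ε * R ^ 2 * t = ε * (R ^ 2 * t) := by ring
    _ ≤ _ := by
      gcongr
      linarith

theorem eq_zero_of_evalPt_eq_zero_on_ball {n : ℕ} {p : MvPolynomial (Fin n) ℝ}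
    {z : EuclideanSpace ℝ (Fin n)} {r : ℝ} (hr : 0 < r) (h : ∀ y ∈ ball z r, evalPt p y = 0) :
    p = 0 := by
  have hopen : IsOpen ((WithLp.toLp 2 : (Fin n → ℝ) → EuclideanSpace ℝ (Fin n)) ⁻¹' ball z r) :=
    isOpen_ball.preimage (PiLp.continuous_toLp 2 _)
  obtain ⟨ε, hε, hsub⟩ := Metric.isOpen_iff.1 hopen (fun i => z i) (by simpa using hr)
  refine MvPolynomial.funext_set (fun i => ball (z i) ε) (fun i => ?_) fun x hx => ?_
  · rw [Real.ball_eq_Ioo]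
    exact Set.Ioo_infinite (by linarith)
  · rw [← ball_pi _ hε] at hx
    have := h _ (hsub hx)
    simpa [evalPt] using this

/-- The strong minimum principle for harmonic polynomials. -/
theorem IsHarmonic.pos_of_nonneg {n : ℕ} (hn : 0 < n) {p : MvPolynomial (Fin n) ℝ}
    (hp : IsHarmonic p) (hp0 : p ≠ 0) {U : Set (EuclideanSpace ℝ (Fin n))} (hU : IsOpen U)
    (hnonneg : ∀ y ∈ U, 0 ≤ evalPt p y) : ∀ y ∈ U, 0 < evalPt p y := by
  intro z hz
  refine (hnonneg z hz).lt_of_ne fun hz0 => ?_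
  obtain ⟨ρ, hρ, hball⟩ := Metric.isOpen_iff.1 hU z hz
  obtain ⟨c, hc, hc0⟩ : ∃ c ∈ ball z (ρ / 2), evalPt p c ≠ 0 := by
    by_contra! h
    exact hp0 (eq_zero_of_evalPt_eq_zero_on_ball (half_pos hρ) h)
  rw [mem_ball] at hc
  have hclosed : IsClosed {y | evalPt p y = 0} :=
    isClosed_eq (continuous_evalPt p) continuous_const
  obtain ⟨w, hw0, hw⟩ := hclosed.exists_infDist_eq_dist ⟨z, hz0.symm⟩ c
  have hRz : dist c w ≤ dist c z := hw ▸ infDist_le_dist_of_mem hz0.symm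
  have hR : 0 < dist c w := dist_pos.2 fun h => hc0 (h ▸ hw0)
  rw [dist_comm c z] at hRz
  have hpos : ∀ y ∈ ball c (dist c w), 0 < evalPt p y := by
    intro y hy
    rw [mem_ball] at hy
    have hyU : y ∈ U := hball <| by
      rw [mem_ball]
      linarith [dist_triangle y c z, dist_comm c z]
    refine (hnonneg y hyU).lt_of_ne fun h => ?_
    have := infDist_le_dist_of_mem (x := c) (show y ∈ {y | evalPt p y = 0} from h.symm)
    rw [hw, dist_comm c y] at this
    linarith
  have hhopf := hp.hopf hn hR hpos (by rw [← dist_eq_norm, dist_comm]) hw0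
  have hwU : w ∈ U := hball <| by
    rw [mem_ball]
    linarith [dist_triangle w c z, dist_comm c z, dist_comm c w]
  have hloc : IsLocalMin (evalPt p) w := by
    filter_upwards [hU.mem_nhds hwU] with y hy
    rw [hw0]
    exact hnonneg y hy
  have hline : IsLocalMin (fun t : ℝ => evalPt p (w + t • (c - w))) 0 :=
    IsLocalMin.comp_continuous (f := evalPt p) (g := fun t : ℝ => w + t • (c - w))
      (by simpa using hloc) (by fun_prop)
  have hder := hasDerivAt_evalPt_line p w (c - w) 0
  simp only [zero_smul, add_zero] at hder
  exact hhopf.ne' (hline.hasDerivAt_eq_zero hder)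

theorem IsHarmonic.exists_neg_of_gradient_eq_zero {n : ℕ} (hn : 0 < n)
    {p : MvPolynomial (Fin n) ℝ} (hp : IsHarmonic p) (hp0 : p ≠ 0) (h0 : evalPt p 0 = 0)
    (hgrad : ∀ i, evalPt (pderiv i p) 0 = 0) {e : EuclideanSpace ℝ (Fin n)} (he : ‖e‖ = 1) :
    ∃ y, ‖y‖ < 1 ∧ 0 < inner ℝ y e ∧ evalPt p y < 0 := by
  by_contra! h
  have hU : IsOpen {y : EuclideanSpace ℝ (Fin n) | ‖y‖ < 1 ∧ 0 < inner ℝ y e} :=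
    (isOpen_lt continuous_norm continuous_const).inter
      (isOpen_lt (g := fun y => inner ℝ y e) continuous_const (by fun_prop))
  have hpos := hp.pos_of_nonneg hn hp0 hU fun y hy => h y hy.1 hy.2
  have hsub : ∀ y ∈ ball ((1 / 2 : ℝ) • e) (1 / 2), 0 < evalPt p y := by
    intro y hy
    rw [mem_ball, dist_eq_norm] at hy
    have h1 : ‖y - (1 / 2 : ℝ) • e‖ ^ 2 < (1 / 2) ^ 2 := by gcongr
    rw [norm_sub_sq_real, inner_smul_right, norm_smul, he] at h1
    norm_num at h1
    have h2 : inner ℝ y e ≤ ‖y‖ := by simpa [he] using real_inner_le_norm y e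
    have h3 : 0 ≤ ‖y‖ ^ 2 := by positivity
    refine hpos y ⟨?_, ?_⟩
    · nlinarith [norm_nonneg y]
    · linarith
  have := hp.hopf hn (by norm_num) hsub (by simp [norm_smul, he]) h0
  simp [hgrad] at this

theorem IsHarmonic.neg {n : ℕ} {p : MvPolynomial (Fin n) ℝ} (hp : IsHarmonic p) :
    IsHarmonic (-p) := by
  unfold IsHarmonic at *
  simp [hp]

/-- A harmonic polynomial with a critical zero at the origin changes sign in every half ball. -/
theorem IsHarmonic.exists_pos_of_gradient_eq_zero {n : ℕ} (hn : 0 < n)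
    {p : MvPolynomial (Fin n) ℝ} (hp : IsHarmonic p) (hp0 : p ≠ 0) (h0 : evalPt p 0 = 0)
    (hgrad : ∀ i, evalPt (pderiv i p) 0 = 0) {e : EuclideanSpace ℝ (Fin n)} (he : ‖e‖ = 1) :
    ∃ y, ‖y‖ < 1 ∧ 0 < inner ℝ y e ∧ 0 < evalPt p y := by
  have := hp.neg.exists_neg_of_gradient_eq_zero hn (neg_ne_zero.2 hp0)
    (by simpa [evalPt] using h0) (by simpa [evalPt] using hgrad) he
  simpa [evalPt] using this

/-- The polynomial with monomials in `T` and given coefficients. -/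
noncomputable def polyOfCoeffs {n : ℕ} (T : Finset (Fin n →₀ ℕ)) :
    (T → ℝ) →ₗ[ℝ] MvPolynomial (Fin n) ℝ :=
  ∑ s : T, (monomial s.1).comp (LinearMap.proj s)

theorem polyOfCoeffs_coeff {n : ℕ} {T : Finset (Fin n →₀ ℕ)} {p : MvPolynomial (Fin n) ℝ}
    (hT : p.support ⊆ T) : polyOfCoeffs T (fun s => coeff s p) = p := by
  simp only [polyOfCoeffs, LinearMap.sum_apply, LinearMap.comp_apply, LinearMap.proj_apply]
  rw [Finset.sum_coe_sort T fun s => monomial s (coeff s p)]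
  conv_rhs => rw [p.as_sum]
  exact (Finset.sum_subset hT fun s _ hs => by simp [notMem_support_iff.1 hs]).symm

theorem coeff_polyOfCoeffs {n : ℕ} {T : Finset (Fin n →₀ ℕ)} (c : T → ℝ) (s : T) :
    coeff s (polyOfCoeffs T c) = c s := by
  simp [polyOfCoeffs, coeff_sum, coeff_monomial]

theorem continuous_linear_polyOfCoeffs {n : ℕ} (T : Finset (Fin n →₀ ℕ))
    (φ : MvPolynomial (Fin n) ℝ →ₗ[ℝ] MvPolynomial (Fin n) ℝ) (y : EuclideanSpace ℝ (Fin n)) :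
    Continuous fun c : T → ℝ => evalPt (φ (polyOfCoeffs T c)) y :=
  (((MvPolynomial.aeval (fun i => y i)).toLinearMap.comp φ).comp
    (polyOfCoeffs T)).continuous_of_finiteDimensional

theorem isCompact_harmonic_normalized {n : ℕ} (T : Finset (Fin n →₀ ℕ)) :
    IsCompact {ce : (T → ℝ) × EuclideanSpace ℝ (Fin n) | ‖ce.1‖ = 1 ∧ ‖ce.2‖ = 1 ∧
      (∀ y, ∑ i, evalPt (pderiv i (pderiv i (polyOfCoeffs T ce.1))) y = 0) ∧
      evalPt (polyOfCoeffs T ce.1) 0 = 0} := by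
  refine ((isCompact_sphere (0 : T → ℝ) 1).prod
    (isCompact_sphere (0 : EuclideanSpace ℝ (Fin n)) 1)).of_isClosed_subset ?_ fun ce h => ?_
  · have hcl : IsClosed {ce : (T → ℝ) × EuclideanSpace ℝ (Fin n) |
        ∀ y, ∑ i, evalPt (pderiv i (pderiv i (polyOfCoeffs T ce.1))) y = 0} := by
      rw [Set.ofPred_forall]
      refine isClosed_iInter fun y => isClosed_eq ?_ continuous_const
      refine continuous_finsetSum _ fun i _ => ?_
      exact (continuous_linear_polyOfCoeffs T
        ((pderiv i).toLinearMap.comp (pderiv i).toLinearMap) y).comp continuous_fst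
    refine (isClosed_eq (by fun_prop) continuous_const).inter
      ((isClosed_eq (by fun_prop) continuous_const).inter (hcl.inter ?_))
    exact isClosed_eq ((continuous_linear_polyOfCoeffs T LinearMap.id 0).comp continuous_fst)
        continuous_const
  · simp [h.1, h.2.1]

/-- Either the gradient at the origin is quantitatively nonzero, or the polynomial takes both
signs in a half ball, quantitatively away from its flat boundary. -/
theorem exists_uniform_gradient_or_sign_change {n : ℕ} (hn : 0 < n) (T : Finset (Fin n →₀ ℕ)) :
    ∃ t > 0, ∀ (c : T → ℝ) (e : EuclideanSpace ℝ (Fin n)), ‖c‖ = 1 → ‖e‖ = 1 →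
      IsHarmonic (polyOfCoeffs T c) → evalPt (polyOfCoeffs T c) 0 = 0 →
      (∃ i, t < |evalPt (pderiv i (polyOfCoeffs T c)) 0|) ∨
      ∃ a b, (‖a‖ < 1 ∧ t < inner ℝ a e ∧ 0 < evalPt (polyOfCoeffs T c) a) ∧
        (‖b‖ < 1 ∧ t < inner ℝ b e ∧ evalPt (polyOfCoeffs T c) b < 0) := by
  let U : Set.Ioi (0 : ℝ) → Set ((T → ℝ) × EuclideanSpace ℝ (Fin n)) := fun t =>
    (⋃ i, {ce | t.1 < |evalPt (pderiv i (polyOfCoeffs T ce.1)) 0|}) ∪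
      ⋃ a, ⋃ b, {ce | (‖a‖ < 1 ∧ t.1 < inner ℝ a ce.2 ∧ 0 < evalPt (polyOfCoeffs T ce.1) a) ∧
        (‖b‖ < 1 ∧ t.1 < inner ℝ b ce.2 ∧ evalPt (polyOfCoeffs T ce.1) b < 0)}
  have : Nonempty (Set.Ioi (0 : ℝ)) := ⟨⟨1, Set.mem_Ioi.2 one_pos⟩⟩
  have hev (y : EuclideanSpace ℝ (Fin n)) : Continuous
      fun ce : (T → ℝ) × EuclideanSpace ℝ (Fin n) => evalPt (polyOfCoeffs T ce.1) y :=
    (continuous_linear_polyOfCoeffs T LinearMap.id y).comp continuous_fst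
  have hin (y : EuclideanSpace ℝ (Fin n)) : Continuous
      fun ce : (T → ℝ) × EuclideanSpace ℝ (Fin n) => inner ℝ y ce.2 := by fun_prop
  have hopen (t : Set.Ioi (0 : ℝ)) : IsOpen (U t) := by
    refine (isOpen_iUnion fun i => ?_).union (isOpen_iUnion fun a => isOpen_iUnion fun b => ?_)
    · exact isOpen_lt continuous_const ((continuous_linear_polyOfCoeffs T
        (pderiv i).toLinearMap 0).comp continuous_fst).abs
    · exact (isOpen_const.inter ((isOpen_lt continuous_const (hin a)).inter
        (isOpen_lt continuous_const (hev a)))).inter (isOpen_const.inter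
        ((isOpen_lt continuous_const (hin b)).inter (isOpen_lt (hev b) continuous_const)))
  have hcover : {ce : (T → ℝ) × EuclideanSpace ℝ (Fin n) | ‖ce.1‖ = 1 ∧ ‖ce.2‖ = 1 ∧
      (∀ y, ∑ i, evalPt (pderiv i (pderiv i (polyOfCoeffs T ce.1))) y = 0) ∧
      evalPt (polyOfCoeffs T ce.1) 0 = 0} ⊆ ⋃ t, U t := by
    rintro ⟨c, e⟩ ⟨hc, he, hh, h0⟩
    simp only at hc he hh h0
    have hharm : IsHarmonic (polyOfCoeffs T c) := by
      refine MvPolynomial.funext fun y => ?_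
      simpa [evalPt] using hh (WithLp.toLp 2 y)
    have hne : polyOfCoeffs T c ≠ 0 := by
      intro h
      have : c = 0 := by
        ext s
        rw [← coeff_polyOfCoeffs c s, h]
        simp
      simp [this] at hc
    by_cases hg : ∀ i, evalPt (pderiv i (polyOfCoeffs T c)) 0 = 0
    · obtain ⟨a, ha1, ha2, ha3⟩ := hharm.exists_pos_of_gradient_eq_zero hn hne h0 hg he
      obtain ⟨b, hb1, hb2, hb3⟩ := hharm.exists_neg_of_gradient_eq_zero hn hne h0 hg he
      obtain ⟨t, ht0, ht⟩ := exists_between (lt_min ha2 hb2)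
      refine Set.mem_iUnion.2 ⟨⟨t, ht0⟩, Or.inr ?_⟩
      simp only [Set.mem_iUnion]
      exact ⟨a, b, ⟨ha1, ht.trans_le (min_le_left _ _), ha3⟩,
        hb1, ht.trans_le (min_le_right _ _), hb3⟩
    · push Not at hg
      obtain ⟨i, hi⟩ := hg
      obtain ⟨t, ht0, ht⟩ := exists_between (abs_pos.2 hi)
      exact Set.mem_iUnion.2 ⟨⟨t, ht0⟩, Or.inl (Set.mem_iUnion.2 ⟨i, ht⟩)⟩
  have hdir : Directed (· ⊆ ·) U := by
    intro s t
    have hmono (r r' : Set.Ioi (0 : ℝ)) (h : r ≤ r') : U r' ⊆ U r := by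
      rintro ce (hce | hce)
      · obtain ⟨i, hi⟩ := Set.mem_iUnion.1 hce
        exact Or.inl (Set.mem_iUnion.2 ⟨i, (Subtype.coe_le_coe.2 h).trans_lt hi.out⟩)
      · simp only [Set.mem_iUnion] at hce
        obtain ⟨a, b, ⟨ha1, ha2, ha3⟩, hb1, hb2, hb3⟩ := hce
        refine Or.inr ?_
        simp only [Set.mem_iUnion]
        exact ⟨a, b, ⟨ha1, lt_of_le_of_lt h ha2, ha3⟩, hb1, lt_of_le_of_lt h hb2, hb3⟩
    exact ⟨min s t, hmono _ _ (min_le_left _ _), hmono _ _ (min_le_right _ _)⟩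
  obtain ⟨t, ht⟩ := (isCompact_harmonic_normalized T).elim_directed_cover U hopen hcover hdir
  refine ⟨t.1, t.2, fun c e hc he hh h0 => ?_⟩
  have := ht (a := (c, e)) ⟨hc, he, hh.sum_evalPt, h0⟩
  simpa [U] using this

/-- Zeros of harmonic polynomials with bounded degree: either the gradient at the origin is
comparable to the largest coefficient, or there are zeros far from any given hyperplane. -/
theorem exists_uniform_gradient_or_zero {n : ℕ} (hn : 0 < n) (T : Finset (Fin n →₀ ℕ)) :
    ∃ t > 0, ∀ q : MvPolynomial (Fin n) ℝ, IsHarmonic q → q ≠ 0 → q.support ⊆ T →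
      evalPt q 0 = 0 → ∃ m > 0, (∀ s, |coeff s q| ≤ m) ∧
        ∀ e : EuclideanSpace ℝ (Fin n), ‖e‖ = 1 →
          (∃ i, t * m < |evalPt (pderiv i q) 0|) ∨
            ∃ y, ‖y‖ ≤ 1 ∧ t < inner ℝ y e ∧ evalPt q y = 0 := by
  obtain ⟨t, ht0, ht⟩ := exists_uniform_gradient_or_sign_change hn T
  refine ⟨t, ht0, fun q hq hq0 hT h0 => ?_⟩
  set c : T → ℝ := fun s => coeff s q with hc
  have hcq : polyOfCoeffs T c = q := polyOfCoeffs_coeff hT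
  have hm : 0 < ‖c‖ := by
    refine norm_pos_iff.2 fun h => hq0 ?_
    rw [← hcq, h, map_zero]
  refine ⟨‖c‖, hm, fun s => ?_, fun e he => ?_⟩
  · by_cases hs : s ∈ T
    · exact norm_le_pi_norm c ⟨s, hs⟩
    · rw [notMem_support_iff.1 fun h => hs (hT h)]
      simp
  have hsm : polyOfCoeffs T (‖c‖⁻¹ • c) = C ‖c‖⁻¹ * q := by
    rw [map_smul, hcq, smul_eq_C_mul]
  have hev (y) : evalPt (C ‖c‖⁻¹ * q) y = ‖c‖⁻¹ * evalPt q y := by simp [evalPt]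
  have hinv : 0 < ‖c‖⁻¹ := inv_pos.2 hm
  have := ht (‖c‖⁻¹ • c) e (by rw [norm_smul, norm_inv, norm_norm, inv_mul_cancel₀ hm.ne']) he
  rw [hsm] at this
  have hharm : IsHarmonic (C ‖c‖⁻¹ * q) := by
    have hq' : ∑ i : Fin n, pderiv i (pderiv i q) = 0 := hq
    simp [IsHarmonic, Derivation.leibniz, ← Finset.mul_sum, hq']
  obtain ⟨i, hi⟩ | ⟨a, b, ⟨ha1, ha2, ha3⟩, hb1, hb2, hb3⟩ := this hharm (by rw [hev, h0, mul_zero])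
  · refine Or.inl ⟨i, ?_⟩
    have hpd : evalPt (pderiv i (C ‖c‖⁻¹ * q)) 0 = ‖c‖⁻¹ * evalPt (pderiv i q) 0 := by
      simp [evalPt, Derivation.leibniz]
    rw [hpd, abs_mul, abs_of_pos hinv, inv_mul_eq_div, lt_div_iff₀ hm] at hi
    exact hi
  · refine Or.inr ?_
    rw [hev] at ha3 hb3
    have ha4 : 0 < evalPt q a := pos_of_mul_pos_right ha3 hinv.le
    have hb4 : evalPt q b < 0 := by
      by_contra! h
      exact hb3.not_ge (mul_nonneg hinv.le h)
    have hconv : Convex ℝ (ball (0 : EuclideanSpace ℝ (Fin n)) 1 ∩ {y | t < inner ℝ y e}) := by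
      refine (convex_ball _ _).inter ?_
      exact convex_halfSpace_gt ⟨fun x y => inner_add_left x y e, fun r x => by
        rw [real_inner_smul_left, smul_eq_mul]⟩ t
    obtain ⟨y, hy, hy0⟩ := hconv.isPreconnected.intermediate_value
      (a := b) (b := a) ⟨by simpa using hb1, hb2⟩ ⟨by simpa using ha1, ha2⟩
      (continuous_evalPt q).continuousOn ⟨hb4.le, ha4.le⟩
    refine ⟨y, ?_, hy.2, hy0⟩
    have := hy.1
    rw [mem_ball_zero_iff] at this
    exact this.le

/-- The polynomial `y ↦ p (x + r • y)`. -/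
noncomputable def affinePoly {n : ℕ} (p : MvPolynomial (Fin n) ℝ)
    (x : EuclideanSpace ℝ (Fin n)) (r : ℝ) : MvPolynomial (Fin n) ℝ :=
  bind₁ (fun i => C (x i) + C r * X i) p

theorem evalPt_affinePoly {n : ℕ} (p : MvPolynomial (Fin n) ℝ)
    (x y : EuclideanSpace ℝ (Fin n)) (r : ℝ) :
    evalPt (affinePoly p x r) y = evalPt p (x + r • y) := by
  unfold evalPt affinePoly
  induction p using MvPolynomial.induction_on with
  | C a => simp
  | add p q hp hq => simp only [map_add, hp, hq]
  | mul_X p j hp =>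
    rw [map_mul, map_mul, hp, map_mul]
    simp

theorem pderiv_affinePoly {n : ℕ} (p : MvPolynomial (Fin n) ℝ)
    (x : EuclideanSpace ℝ (Fin n)) (r : ℝ) (i : Fin n) :
    pderiv i (affinePoly p x r) = C r * affinePoly (pderiv i p) x r := by
  unfold affinePoly
  induction p using MvPolynomial.induction_on with
  | C a => simp
  | add p q hp hq => simp only [map_add, hp, hq, mul_add]
  | mul_X p j hp =>
    rw [map_mul, Derivation.leibniz, hp, Derivation.leibniz]
    simp only [bind₁_X_right, map_add, map_mul, pderiv_C, Derivation.leibniz, smul_eq_mul,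
      pderiv_X, mul_zero, add_zero, zero_add]
    rcases eq_or_ne i j with rfl | hij
    · simp
      ring
    · simp [hij.symm]
      ring

theorem IsHarmonic.affinePoly {n : ℕ} {p : MvPolynomial (Fin n) ℝ} (hp : IsHarmonic p)
    (x : EuclideanSpace ℝ (Fin n)) (r : ℝ) : IsHarmonic (affinePoly p x r) := by
  have h (i : Fin n) : pderiv i (pderiv i (_root_.affinePoly p x r)) =
      C (r ^ 2) * _root_.affinePoly (pderiv i (pderiv i p)) x r := by
    rw [pderiv_affinePoly, Derivation.leibniz, pderiv_affinePoly]
    simp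
    ring
  have hp' : ∑ i : Fin n, pderiv i (pderiv i p) = 0 := hp
  unfold IsHarmonic
  simp only [h, ← Finset.mul_sum]
  unfold _root_.affinePoly
  rw [← map_sum, hp', map_zero, mul_zero]

theorem totalDegree_affinePoly_le {n : ℕ} (p : MvPolynomial (Fin n) ℝ)
    (x : EuclideanSpace ℝ (Fin n)) (r : ℝ) : (affinePoly p x r).totalDegree ≤ p.totalDegree := by
  unfold affinePoly
  conv_lhs => rw [p.as_sum, map_sum]
  refine totalDegree_finsetSum_le fun s hs => ?_
  rw [bind₁_monomial]
  refine (totalDegree_mul _ _).trans ?_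
  rw [totalDegree_C, zero_add]
  refine (totalDegree_finsetProd _ _).trans ?_
  refine le_trans (Finset.sum_le_sum fun i _ => ?_) (le_totalDegree hs)
  refine (totalDegree_pow _ _).trans ?_
  refine mul_le_of_le_one_right (Nat.zero_le _) ?_
  refine (totalDegree_add _ _).trans (max_le (by simp) ?_)
  exact (totalDegree_mul _ _).trans (by simp)

theorem support_affinePoly_subset {n d : ℕ} {p : MvPolynomial (Fin n) ℝ} (hp : p.totalDegree ≤ d)
    (x : EuclideanSpace ℝ (Fin n)) (r : ℝ) : (affinePoly p x r).support ⊆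
      (Finsupp.finite_of_degree_le (σ := Fin n) d).toFinset := by
  intro u hu
  rw [Set.Finite.mem_toFinset]
  exact (le_totalDegree hu).trans ((totalDegree_affinePoly_le p x r).trans hp)

theorem affinePoly_ne_zero {n : ℕ} {p : MvPolynomial (Fin n) ℝ} (hp : p ≠ 0)
    (x : EuclideanSpace ℝ (Fin n)) {r : ℝ} (hr : r ≠ 0) : affinePoly p x r ≠ 0 := by
  intro h
  refine hp (MvPolynomial.funext fun y => ?_)
  have := evalPt_affinePoly p x (r⁻¹ • (WithLp.toLp 2 y - x)) r
  rw [h, smul_inv_smul₀ hr] at this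
  simpa [evalPt] using this.symm

theorem abs_evalPt_monomial_sub_le {n : ℕ} {s : Fin n →₀ ℕ} (hs : s ≠ 0) (a : ℝ)
    {y : EuclideanSpace ℝ (Fin n)} (hy : ‖y‖ ≤ 1) :
    |evalPt (monomial s a) y - ∑ i, y i * evalPt (pderiv i (monomial s a)) 0| ≤
      |a| * ‖y‖ ^ 2 := by
  have heval0 (u : Fin n →₀ ℕ) (hu : u ≠ 0) (b : ℝ) :
      evalPt (monomial u b) (0 : EuclideanSpace ℝ (Fin n)) = 0 := by
    obtain ⟨i, hi⟩ := Finsupp.ne_iff.1 hu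
    simp only [evalPt, eval_monomial, mul_eq_zero]
    right
    exact Finset.prod_eq_zero (Finsupp.mem_support_iff.2 hi) (zero_pow hi)
  by_cases h1 : ∃ j, s = Finsupp.single j 1
  · obtain ⟨j, rfl⟩ := h1
    have : ∑ i, y i * evalPt (pderiv i (monomial (Finsupp.single j 1) a)) 0 = y j * a := by
      rw [Finset.sum_eq_single j]
      · simp [evalPt, pderiv_monomial]
      · intro i _ hi
        simp [evalPt, pderiv_monomial, hi]
      · simp
    rw [this]
    simp only [evalPt, eval_monomial, Finsupp.prod_single_index, pow_zero, pow_one]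
    rw [mul_comm, sub_self, abs_zero]
    positivity
  · push Not at h1
    have h0 : ∑ i, y i * evalPt (pderiv i (monomial s a)) 0 = 0 := by
      refine Finset.sum_eq_zero fun i _ => ?_
      rw [pderiv_monomial]
      by_cases hi : s i = 0
      · simp [hi, evalPt]
      · rw [heval0, mul_zero]
        intro h
        apply h1 i
        have hle : s ≤ Finsupp.single i 1 := tsub_eq_zero_iff_le.1 h
        refine le_antisymm hle ?_
        rw [Finsupp.single_le_iff]
        exact Nat.one_le_iff_ne_zero.2 hi
    have hdeg : 2 ≤ s.degree := by
      by_contra! hlt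
      interval_cases hd : s.degree
      · exact hs ((Finsupp.degree_eq_zero_iff s).1 hd)
      · obtain ⟨i, hi⟩ := (Set.ext_iff.1 Finsupp.range_single_one s).2 hd
        exact h1 i hi.symm
    rw [h0, sub_zero, evalPt, eval_monomial, abs_mul]
    gcongr
    rw [Finsupp.prod, Finset.abs_prod]
    calc ∏ i ∈ s.support, |y i ^ s i| ≤ ∏ i ∈ s.support, ‖y‖ ^ s i := by
          refine Finset.prod_le_prod (fun i _ => abs_nonneg _) fun i _ => ?_
          rw [abs_pow]
          gcongr
          exact PiLp.norm_apply_le y i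
      _ = ‖y‖ ^ s.degree := by rw [Finset.prod_pow_eq_pow_sum, Finsupp.degree]; rfl
      _ ≤ ‖y‖ ^ 2 := pow_le_pow_of_le_one (norm_nonneg _) hy hdeg

/-- First order Taylor estimate at a zero of a polynomial. -/
theorem abs_evalPt_sub_le {n : ℕ} {p : MvPolynomial (Fin n) ℝ} (hp0 : evalPt p 0 = 0)
    {y : EuclideanSpace ℝ (Fin n)} (hy : ‖y‖ ≤ 1) :
    |evalPt p y - ∑ i, y i * evalPt (pderiv i p) 0| ≤
      (∑ s ∈ p.support, |coeff s p|) * ‖y‖ ^ 2 := by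
  let D : MvPolynomial (Fin n) ℝ →ₗ[ℝ] ℝ := (aeval fun i => y i).toLinearMap -
    ∑ i, y i • (aeval fun i => (0 : EuclideanSpace ℝ (Fin n)) i).toLinearMap.comp
      (pderiv i).toLinearMap
  have hD (q : MvPolynomial (Fin n) ℝ) :
      D q = evalPt q y - ∑ i, y i * evalPt (pderiv i q) 0 := by
    simp [D, evalPt, aeval_eq_eval, LinearMap.sum_apply]
  rw [← hD]
  conv_lhs => rw [p.as_sum]
  rw [map_sum, Finset.sum_mul]
  refine (Finset.abs_sum_le_sum_abs _ _).trans (Finset.sum_le_sum fun s hs => ?_)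
  rw [hD]
  refine abs_evalPt_monomial_sub_le ?_ _ hy
  rintro rfl
  rw [mem_support_iff, ← constantCoeff_eq] at hs
  refine hs ?_
  rw [← hp0, constantCoeff_eq, ← constantCoeff_eq, ← eval_zero]
  rfl

theorem finrank_orthogonal_span_singleton_eq {n : ℕ} {a : EuclideanSpace ℝ (Fin n)} (ha : a ≠ 0) :
    Module.finrank ℝ (ℝ ∙ a)ᗮ = n - 1 := by
  have h := (ℝ ∙ a).finrank_add_finrank_orthogonal
  rw [finrank_span_singleton ha, finrank_euclideanSpace_fin] at h
  omega

/-- An affine approximation with quadratic error controls the flatness of the zero set. -/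
theorem flatness_zeroSet_le {n : ℕ} {h : MvPolynomial (Fin n) ℝ}
    {x a : EuclideanSpace ℝ (Fin n)} {r M s : ℝ} (hr : 0 < r) (ha : a ≠ 0) (hM : 0 ≤ M)
    (happrox : ∀ y : EuclideanSpace ℝ (Fin n), ‖y‖ ≤ 1 →
      |evalPt h (x + r • y) - inner ℝ a y| ≤ M * ‖y‖ ^ 2)
    (hs : 0 < s) (hs1 : s ≤ 1) :
    flatness (zeroSet h) x (s * r) ≤ 2 * M * s / ‖a‖ := by
  have ha' : 0 < ‖a‖ := norm_pos_iff.2 ha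
  have hx0 : evalPt h x = 0 := by simpa using happrox 0 (by simp)
  set τ : ℝ := M * s ^ 2 / ‖a‖ with hτ
  have hτ0 : 0 ≤ τ := by positivity
  have hτa : τ * ‖a‖ = M * s ^ 2 := div_mul_cancel₀ _ ha'.ne'
  set u : EuclideanSpace ℝ (Fin n) := ‖a‖⁻¹ • a with hu
  have hu1 : ‖u‖ = 1 := norm_smul_inv_norm ha
  have hau : inner ℝ a u = ‖a‖ := by
    rw [hu, inner_smul_right, real_inner_self_eq_norm_sq]
    field_simp
  have huy (y : EuclideanSpace ℝ (Fin n)) : inner ℝ u y = inner ℝ a y / ‖a‖ := by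
    rw [hu, real_inner_smul_left]
    field_simp
  have hmem (y : EuclideanSpace ℝ (Fin n)) :
      x + r • y ∈ closedBall x (s * r) ↔ ‖y‖ ≤ s := by
    rw [mem_closedBall, dist_eq_norm, add_sub_cancel_left, norm_smul, Real.norm_of_nonneg hr.le,
      mul_comm, mul_le_mul_iff_left₀ hr]
  suffices hausdorffDist (zeroSet h ∩ closedBall x (s * r))
      (((fun y => x + y) '' ((ℝ ∙ a)ᗮ : Set (EuclideanSpace ℝ (Fin n)))) ∩
        closedBall x (s * r)) ≤ 2 * τ * r by
    have hle := (ciInf_le (f := fun L : {L : Submodule ℝ (EuclideanSpace ℝ (Fin n)) //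
        Module.finrank ℝ L = n - 1} => hausdorffDist (zeroSet h ∩ closedBall x (s * r))
        (((fun y => x + y) '' (L.1 : Set (EuclideanSpace ℝ (Fin n)))) ∩ closedBall x (s * r)))
      ⟨0, by rintro _ ⟨L, rfl⟩; exact hausdorffDist_nonneg⟩
      ⟨(ℝ ∙ a)ᗮ, finrank_orthogonal_span_singleton_eq ha⟩).trans this
    calc flatness (zeroSet h) x (s * r) ≤ 1 / (s * r) * (2 * τ * r) := by
          unfold flatness
          gcongr
      _ = 2 * M * s / ‖a‖ := by
          rw [hτ]
          field_simp
  refine hausdorffDist_le_of_mem_dist (by positivity) ?_ ?_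
  · rintro z ⟨hz0, hz⟩
    obtain ⟨y, rfl⟩ : ∃ y, z = x + r • y := ⟨r⁻¹ • (z - x), by rw [smul_inv_smul₀ hr.ne']; abel⟩
    rw [hmem] at hz
    have hay : |inner ℝ a y| ≤ M * s ^ 2 := by
      have := happrox y (hz.trans hs1)
      rw [show evalPt h (x + r • y) = 0 from hz0, zero_sub, abs_neg] at this
      exact this.trans (by gcongr)
    have huyτ : |inner ℝ u y| ≤ τ := by
      rw [huy, abs_div, abs_norm, hτ]
      gcongr
    set y' := y - inner ℝ u y • u with hy'
    refine ⟨x + r • y', ⟨⟨r • y', ?_, rfl⟩, ?_⟩, ?_⟩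
    · rw [SetLike.mem_coe]
      refine Submodule.smul_mem _ _ ?_
      rw [Submodule.mem_orthogonal_singleton_iff_inner_right, hy', inner_sub_right,
        inner_smul_right, hau, huy]
      field_simp
      ring
    · rw [hmem]
      refine le_trans ?_ hz
      have h1 : ‖y'‖ ^ 2 = ‖y‖ ^ 2 - inner ℝ u y ^ 2 := by
        rw [hy', norm_sub_sq_real, inner_smul_right, norm_smul, hu1, real_inner_comm u y,
          Real.norm_eq_abs, mul_one, sq_abs]
        ring
      refine le_of_sq_le_sq ?_ (norm_nonneg _)
      nlinarith [sq_nonneg (inner ℝ u y)]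
    · rw [dist_add_left, dist_smul₀, Real.norm_of_nonneg hr.le, dist_eq_norm, hy', sub_sub_cancel,
        norm_smul, hu1, Real.norm_eq_abs, mul_one]
      nlinarith
  · rintro z ⟨⟨l, hl, rfl⟩, hz⟩
    obtain ⟨y, rfl⟩ : ∃ y, l = r • y := ⟨r⁻¹ • l, by rw [smul_inv_smul₀ hr.ne']⟩
    simp only at hz ⊢
    have hay : inner ℝ a y = 0 := by
      rw [SetLike.mem_coe, Submodule.mem_orthogonal_singleton_iff_inner_right,
        inner_smul_right] at hl
      exact (mul_eq_zero.1 hl).resolve_left hr.ne'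
    rw [hmem] at hz
    rcases le_total s τ with hsτ | hsτ
    · refine ⟨x, ⟨hx0, mem_closedBall_self (by positivity)⟩, ?_⟩
      rw [dist_eq_norm, add_sub_cancel_left, norm_smul, Real.norm_of_nonneg hr.le]
      nlinarith
    · have hτs : τ / s ≤ 1 := (div_le_one hs).2 hsτ
      have hτs0 : 0 ≤ τ / s := by positivity
      set y' := (1 - τ / s) • y with hy'
      have hy'n : ‖y'‖ ≤ s - τ := by
        rw [hy', norm_smul, Real.norm_of_nonneg (by linarith)]
        calc (1 - τ / s) * ‖y‖ ≤ (1 - τ / s) * s := by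
              gcongr
          _ = s - τ := by field_simp
      have hnorm (w : ℝ) (hw : |w| ≤ τ) : ‖y' + w • u‖ ≤ s := by
        refine (norm_add_le _ _).trans ?_
        rw [norm_smul w u, hu1, Real.norm_eq_abs, mul_one]
        linarith
      have hinner (w : ℝ) : inner ℝ a (y' + w • u) = w * ‖a‖ := by
        rw [inner_add_right, hy', inner_smul_right, hay, inner_smul_right, hau]
        ring
      have hest (w : ℝ) (hw : |w| ≤ τ) :
          |evalPt h (x + r • (y' + w • u)) - w * ‖a‖| ≤ M * s ^ 2 := by
        have := happrox _ ((hnorm w hw).trans hs1)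
        rw [hinner] at this
        refine this.trans ?_
        have := hnorm w hw
        gcongr
      have hcont : Continuous fun w : ℝ => evalPt h (x + r • (y' + w • u)) :=
        (continuous_evalPt h).comp (by fun_prop)
      have hlo : evalPt h (x + r • (y' + (-τ) • u)) ≤ 0 := by
        have := (abs_le.1 (hest (-τ) (by rw [abs_neg, abs_of_nonneg hτ0]))).2
        linarith
      have hhi : 0 ≤ evalPt h (x + r • (y' + τ • u)) := by
        have := (abs_le.1 (hest τ (by rw [abs_of_nonneg hτ0]))).1
        linarith
      obtain ⟨w, hw, hw0⟩ := intermediate_value_Icc (by linarith : -τ ≤ τ) hcont.continuousOn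
        ⟨hlo, hhi⟩
      have hwτ : |w| ≤ τ := abs_le.2 hw
      refine ⟨x + r • (y' + w • u), ⟨hw0, (hmem _).2 (hnorm w hwτ)⟩, ?_⟩
      have hd : ‖y - (y' + w • u)‖ ≤ 2 * τ := by
        have : y - (y' + w • u) = (τ / s) • y - w • u := by
          rw [hy']
          module
        rw [this]
        refine (norm_sub_le _ _).trans ?_
        rw [norm_smul, norm_smul, hu1, Real.norm_of_nonneg hτs0, Real.norm_eq_abs, mul_one]
        have : τ / s * ‖y‖ ≤ τ / s * s := by gcongr
        rw [div_mul_cancel₀ _ hs.ne'] at this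
        linarith
      rw [dist_add_left, dist_smul₀, Real.norm_of_nonneg hr.le, dist_eq_norm]
      nlinarith

/-- If the zero set is flat at scale `r`, then all its zeros at this scale are close to a
hyperplane. -/
theorem exists_normal_of_flatness_lt {n : ℕ} (hn : 0 < n) {h : MvPolynomial (Fin n) ℝ}
    {x : EuclideanSpace ℝ (Fin n)} {r δ : ℝ} (hr : 0 < r)
    (hflat : flatness (zeroSet h) x r < δ) :
    ∃ e : EuclideanSpace ℝ (Fin n), ‖e‖ = 1 ∧ ∀ y, ‖y‖ ≤ 1 → evalPt h (x + r • y) = 0 →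
      inner ℝ y e ≤ δ := by
  have : NeZero n := ⟨hn.ne'⟩
  have hne : Nonempty {L : Submodule ℝ (EuclideanSpace ℝ (Fin n)) //
      Module.finrank ℝ L = n - 1} :=
    ⟨⟨(ℝ ∙ EuclideanSpace.single (0 : Fin n) (1 : ℝ))ᗮ,
      finrank_orthogonal_span_singleton_eq (by simp)⟩⟩
  rw [flatness, one_div, inv_mul_eq_div, div_lt_iff₀ hr] at hflat
  obtain ⟨⟨L, hL⟩, hlt⟩ := exists_lt_of_ciInf_lt hflat
  simp only at hlt
  obtain ⟨v, hvL, hv⟩ : ∃ v ∈ Lᗮ, v ≠ 0 := by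
    refine Submodule.exists_mem_ne_zero_of_ne_bot fun hbot => ?_
    have := L.finrank_add_finrank_orthogonal
    rw [hbot, finrank_bot, hL, finrank_euclideanSpace_fin] at this
    omega
  refine ⟨‖v‖⁻¹ • v, norm_smul_inv_norm hv, fun y hy hy0 => ?_⟩
  set e := ‖v‖⁻¹ • v with he
  have he1 : ‖e‖ = 1 := norm_smul_inv_norm hv
  have heL : e ∈ Lᗮ := Submodule.smul_mem _ _ hvL
  have hmem : x + r • y ∈ zeroSet h ∩ closedBall x r := by
    refine ⟨hy0, ?_⟩
    rw [mem_closedBall, dist_eq_norm, add_sub_cancel_left, norm_smul, Real.norm_of_nonneg hr.le]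
    nlinarith
  have hxL : x ∈ ((fun y => x + y) '' (L : Set (EuclideanSpace ℝ (Fin n)))) ∩ closedBall x r :=
    ⟨⟨0, L.zero_mem, add_zero x⟩, mem_closedBall_self hr.le⟩
  obtain ⟨z, ⟨⟨l, hl, rfl⟩, -⟩, hz⟩ := exists_dist_lt_of_hausdorffDist_lt hmem hlt
    (hausdorffEDist_ne_top_of_nonempty_of_bounded ⟨_, hmem⟩ ⟨x, hxL⟩
      (isBounded_closedBall.subset Set.inter_subset_right)
      (isBounded_closedBall.subset Set.inter_subset_right))
  simp only [dist_add_left] at hz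
  rw [dist_eq_norm] at hz
  have h1 : inner ℝ (r • y - l) e = r * inner ℝ y e := by
    rw [inner_sub_left, real_inner_smul_left, (Submodule.mem_orthogonal L e).1 heL l hl, sub_zero]
  have h2 := real_inner_le_norm (r • y - l) e
  rw [h1, he1, mul_one] at h2
  by_contra! hlt'
  nlinarith

/-- A lower bound for the gradient and an upper bound for the coefficients control the flatness of
the zero set at all smaller scales. -/
theorem flatness_zeroSet_le_of_gradient {n : ℕ} {h : MvPolynomial (Fin n) ℝ}
    {x : EuclideanSpace ℝ (Fin n)} (hx : x ∈ zeroSet h) {r M η s : ℝ} (hr : 0 < r)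
    (hM : ∑ u ∈ (affinePoly h x r).support, |coeff u (affinePoly h x r)| ≤ M) (hη : 0 < η)
    {i : Fin n} (hi : η ≤ |evalPt (pderiv i (affinePoly h x r)) 0|) (hs : 0 < s) (hs1 : s ≤ 1) :
    flatness (zeroSet h) x (s * r) ≤ 2 * M * s / η := by
  set q := affinePoly h x r with hq
  have hM0 : 0 ≤ M := (Finset.sum_nonneg fun _ _ => abs_nonneg _).trans hM
  have hq0 : evalPt q 0 = 0 := by
    rw [hq, evalPt_affinePoly, smul_zero, add_zero]
    exact hx
  set a : EuclideanSpace ℝ (Fin n) := WithLp.toLp 2 fun i => evalPt (pderiv i q) 0 with ha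
  have hηa : η ≤ ‖a‖ := hi.trans (PiLp.norm_apply_le a i)
  have ha0 : a ≠ 0 := norm_pos_iff.1 (hη.trans_le hηa)
  refine (flatness_zeroSet_le hr ha0 hM0 (fun y hy => ?_) hs hs1).trans (by gcongr)
  have hinner : inner ℝ a y = ∑ i, y i * evalPt (pderiv i q) 0 := by
    simp [PiLp.inner_apply, ha]
  rw [← evalPt_affinePoly, hinner]
  exact (abs_evalPt_sub_le hq0 hy).trans (by gcongr)

theorem evalPt_pderiv_affinePoly_zero {n : ℕ} (p : MvPolynomial (Fin n) ℝ)
    (x : EuclideanSpace ℝ (Fin n)) (r : ℝ) (i : Fin n) :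
    evalPt (pderiv i (affinePoly p x r)) 0 = r * evalPt (pderiv i p) x := by
  have h := evalPt_affinePoly (pderiv i p) x 0 r
  rw [smul_zero, add_zero] at h
  rw [← h, pderiv_affinePoly]
  simp [evalPt]

theorem exists_flatness_lt_of_gradNeZero {n : ℕ} {h : MvPolynomial (Fin n) ℝ}
    {x : EuclideanSpace ℝ (Fin n)} (hx : x ∈ zeroSet h) (hg : gradNeZero h x) {t : ℝ}
    (ht : 0 < t) : ∃ r > (0 : ℝ), flatness (zeroSet h) x r < t := by
  obtain ⟨i, hi⟩ := hg
  set η := |evalPt (pderiv i (affinePoly h x 1)) 0| with hη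
  have hη0 : 0 < η := by
    rw [hη, evalPt_pderiv_affinePoly_zero, one_mul]
    exact abs_pos.2 hi
  set M := ∑ u ∈ (affinePoly h x 1).support, |coeff u (affinePoly h x 1)|
  have hM0 : 0 ≤ M := Finset.sum_nonneg fun _ _ => abs_nonneg _
  set s := min 1 (t * η / (4 * (M + 1)))
  have hs : 0 < s := lt_min one_pos (by positivity)
  refine ⟨s * 1, by linarith, ?_⟩
  refine (flatness_zeroSet_le_of_gradient hx one_pos le_rfl hη0 hη.le hs
    (min_le_left _ _)).trans_lt ?_
  rw [div_lt_iff₀ hη0]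
  have h1 : s ≤ t * η / (4 * (M + 1)) := min_le_right _ _
  rw [le_div_iff₀ (by positivity)] at h1
  nlinarith [mul_pos ht hη0]

/-- Main theorem: flat points of zero sets of harmonic polynomials are exactly the
regular points, quantitatively. -/
theorem harmonic_flat_dichotomy (n d : ℕ) (hn : 2 ≤ n) (hd : 1 ≤ d) :
    ∃ δ C : ℝ, 0 < δ ∧ 1 < C ∧
      ∀ h : MvPolynomial (Fin n) ℝ, IsHarmonic h → h.totalDegree = d →
        ∀ x ∈ zeroSet h,
          ((¬ gradNeZero h x) ↔ ∀ r > (0 : ℝ), δ ≤ flatness (zeroSet h) x r) ∧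
          (gradNeZero h x ↔ ∃ r > (0 : ℝ), flatness (zeroSet h) x r < δ) ∧
          (∀ r > (0 : ℝ), flatness (zeroSet h) x r < δ →
            ∀ s : ℝ, 0 < s → s < 1 → flatness (zeroSet h) x (s * r) < C * s) := by
  have hn0 : 0 < n := by omega
  set T : Finset (Fin n →₀ ℕ) := (Finsupp.finite_of_degree_le (σ := Fin n) d).toFinset with hT
  obtain ⟨t, ht0, ht⟩ := exists_uniform_gradient_or_zero hn0 T
  have key : ∀ h : MvPolynomial (Fin n) ℝ, IsHarmonic h → h.totalDegree = d → ∀ x ∈ zeroSet h,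
      ∀ r > (0 : ℝ), flatness (zeroSet h) x r < t →
        ∃ i, ∃ m > 0, (∀ u, |coeff u (affinePoly h x r)| ≤ m) ∧
          t * m < |evalPt (pderiv i (affinePoly h x r)) 0| := by
    intro h hh hdeg x hx r hr hflat
    have hne : h ≠ 0 := by
      rintro rfl
      rw [totalDegree_zero] at hdeg
      omega
    obtain ⟨m, hm, hcoeff, halt⟩ := ht (affinePoly h x r) (hh.affinePoly x r)
      (affinePoly_ne_zero hne x hr.ne') (support_affinePoly_subset hdeg.le x r)
      (by rw [evalPt_affinePoly, smul_zero, add_zero]; exact hx)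
    obtain ⟨e, he, hzeros⟩ := exists_normal_of_flatness_lt hn0 hr hflat
    obtain ⟨i, hi⟩ | ⟨y, hy, hye, hy0⟩ := halt e he
    · exact ⟨i, m, hm, hcoeff, hi⟩
    · rw [evalPt_affinePoly] at hy0
      exact absurd (hzeros y hy hy0) (not_le.2 hye)
  have hiff : ∀ h : MvPolynomial (Fin n) ℝ, IsHarmonic h → h.totalDegree = d →
      ∀ x ∈ zeroSet h, (gradNeZero h x ↔ ∃ r > (0 : ℝ), flatness (zeroSet h) x r < t) := by
    refine fun h hh hdeg x hx => ⟨fun hg => exists_flatness_lt_of_gradNeZero hx hg ht0, ?_⟩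
    rintro ⟨r, hr, hflat⟩
    obtain ⟨i, m, hm, -, hi⟩ := key h hh hdeg x hx r hr hflat
    refine ⟨i, fun h0 => ?_⟩
    rw [evalPt_pderiv_affinePoly_zero, evalPt, h0, mul_zero, abs_zero] at hi
    exact hi.not_gt (mul_pos ht0 hm)
  refine ⟨t, 2 * T.card / t + 2, ht0, by linarith [show 0 ≤ 2 * (T.card : ℝ) / t by positivity],
    fun h hh hdeg x hx => ⟨?_, hiff h hh hdeg x hx, ?_⟩⟩
  · rw [hiff h hh hdeg x hx]
    push Not
    rfl
  · intro r hr hflat s hs hs1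
    obtain ⟨i, m, hm, hcoeff, hi⟩ := key h hh hdeg x hx r hr hflat
    have hsum : ∑ u ∈ (affinePoly h x r).support, |coeff u (affinePoly h x r)| ≤ T.card * m := by
      refine (Finset.sum_le_card_nsmul _ _ m fun u _ => hcoeff u).trans ?_
      rw [nsmul_eq_mul]
      gcongr
      exact support_affinePoly_subset hdeg.le x r
    refine (flatness_zeroSet_le_of_gradient hx hr hsum (mul_pos ht0 hm) hi.le hs
      hs1.le).trans_lt ?_
    have : 2 * (T.card * m) * s / (t * m) = 2 * T.card / t * s := by field_simp
    rw [this]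
    linarith
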